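/- arXiv:2405.02170 — 2 statements merged into one kernel-verified Lean document; each statement's English description precedes it below -/
import Mathlib

section
/- Fix ε > 0 and let (p_k)_{k∈ℕ} be the Taylor coefficients of x ↦ exp(εx²), i.e. p_{2m} = ε^m / m! and p_{2m+1} = 0 for all m ∈ ℕ. Then limsup_{k→∞} ( |p_k| · (k−1)!! )^{1/k} = √(2ε). In particular, exp(εx²) is not negligible to double factorial. -/
open Filter Topology in
/-- A nonnegative sequence bounded by `s` whose terms of positive even index `k` are at least
`s / k ^ (1 / k)` has limit superior `s`. -/
theorem limsup_eq_of_even_lower_bound {u : ℕ → ℝ} {s : ℝ} (h0 : ∀ k, 0 ≤ u k)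
    (hle : ∀ᶠ k in atTop, u k ≤ s)
    (hge : ∀ n : ℕ, s / ((2 * (n + 1) : ℕ) : ℝ) ^ ((1 : ℝ) / (2 * (n + 1) : ℕ)) ≤
      u (2 * (n + 1))) :
    limsup u atTop = s := by
  have hcob : IsCoboundedUnder (· ≤ ·) atTop u :=
    (isBoundedUnder_of ⟨0, h0⟩ : IsBoundedUnder (· ≥ ·) atTop u).isCoboundedUnder_le
  refine le_antisymm (limsup_le_of_le hcob hle) (le_of_forall_lt_imp_le_of_dense fun b hb => ?_)
  refine le_limsup_of_frequently_le ?_ ⟨s, hle⟩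
  have hlim : Tendsto (fun k : ℕ => s / (k : ℝ) ^ ((1 : ℝ) / k)) atTop (𝓝 s) := by
    have h := (tendsto_const_nhds (x := s)).div
      (tendsto_rpow_div.comp tendsto_natCast_atTop_atTop) one_ne_zero
    rw [div_one] at h
    exact h
  obtain ⟨N, hN⟩ := eventually_atTop.1 (hlim.eventually (lt_mem_nhds hb))
  refine frequently_atTop.2 fun a => ⟨2 * (a + N + 1), by lia, ?_⟩
  exact (hN (2 * (a + N + 1)) (by lia)).le.trans (hge (a + N))

open Nat in
/-- The double factorial `(2n + 1)‼` lies between `(2n)‼ = 2 ^ n n!` and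
`(2n + 2)‼ = 2 ^ (n + 1) (n + 1)!`. -/
theorem doubleFactorial_odd_bounds (n : ℕ) :
    2 ^ n * n ! ≤ (2 * n + 1)‼ ∧ (2 * n + 1)‼ ≤ 2 ^ (n + 1) * (n + 1)! := by
  induction n with
  | zero => decide
  | succ n ih =>
    obtain ⟨h1, h2⟩ := ih
    rw [show 2 * (n + 1) + 1 = (2 * n + 1) + 2 by ring, Nat.doubleFactorial_add_two]
    constructor
    · calc 2 ^ (n + 1) * (n + 1)! = (2 * n + 2) * (2 ^ n * n !) := by
            rw [Nat.factorial_succ]; ring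
        _ ≤ _ := Nat.mul_le_mul (by lia) h1
    · calc (2 * n + 1 + 2) * (2 * n + 1)‼ ≤ (2 * n + 4) * (2 ^ (n + 1) * (n + 1)!) :=
            Nat.mul_le_mul (by lia) h2
        _ = _ := by rw [Nat.factorial_succ (n + 1)]; ring


/-- A power series with real coefficients `p` is *negligible to double factorial* if
`limsup_{k→∞} (|p_k| (k-1)!!)^(1/k) = 0`, with the convention `(-1)!! = 0!! = 1`. -/
def negligibleDF (p : ℕ → ℝ) : Prop :=
  Filter.limsup
    (fun k : ℕ => (|p k| * (Nat.doubleFactorial (k - 1) : ℝ)) ^ ((1 : ℝ) / k))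
    Filter.atTop = 0

/-- For `ε > 0`, the Taylor coefficients of `x ↦ exp(εx²)`, namely
`p_{2m} = ε^m / m!` and `p_{2m+1} = 0`, satisfy
`limsup_{k→∞} (|p_k| (k-1)!!)^(1/k) = √(2ε)`; in particular `exp(εx²)` is not
negligible to double factorial. -/
theorem stmt3 (ε : ℝ) (hε : 0 < ε) (p : ℕ → ℝ)
    (hpe : ∀ m : ℕ, p (2 * m) = ε ^ m / (Nat.factorial m : ℝ))
    (hpo : ∀ m : ℕ, p (2 * m + 1) = 0) :
    Filter.limsup
        (fun k : ℕ => (|p k| * (Nat.doubleFactorial (k - 1) : ℝ)) ^ ((1 : ℝ) / k))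
        Filter.atTop = Real.sqrt (2 * ε) ∧
    ¬ negligibleDF p := by
  have hs : 0 < Real.sqrt (2 * ε) := Real.sqrt_pos.2 (by positivity)
  have hpow (n : ℕ) : Real.sqrt (2 * ε) =
      ((2 * ε) ^ (n + 1)) ^ ((1 : ℝ) / (2 * (n + 1) : ℕ)) := by
    rw [Real.sqrt_eq_rpow, ← Real.rpow_natCast, ← Real.rpow_mul (by positivity)]
    congr 1
    push_cast
    field_simp
  have hcoeff (n : ℕ) : |p (2 * (n + 1))| * (Nat.doubleFactorial (2 * (n + 1) - 1) : ℝ) =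
      ε ^ (n + 1) / (Nat.factorial (n + 1) : ℝ) * (Nat.doubleFactorial (2 * n + 1) : ℝ) := by
    rw [hpe, abs_of_pos (by positivity), show 2 * (n + 1) - 1 = 2 * n + 1 by lia]
  have hlim : Filter.limsup
      (fun k : ℕ => (|p k| * (Nat.doubleFactorial (k - 1) : ℝ)) ^ ((1 : ℝ) / k))
      Filter.atTop = Real.sqrt (2 * ε) := by
    refine limsup_eq_of_even_lower_bound (fun k => by positivity) ?_ fun n => ?_
    · filter_upwards [Filter.eventually_gt_atTop 0] with k hk
      obtain ⟨m, rfl | rfl⟩ := k.even_or_odd'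
      · obtain ⟨n, rfl⟩ : ∃ n, m = n + 1 := ⟨m - 1, by lia⟩
        rw [hcoeff, hpow n]
        refine Real.rpow_le_rpow (by positivity) ?_ (by positivity)
        have h : (Nat.doubleFactorial (2 * n + 1) : ℝ) ≤ 2 ^ (n + 1) * Nat.factorial (n + 1) := by
          exact_mod_cast (doubleFactorial_odd_bounds n).2
        rw [div_mul_eq_mul_div, div_le_iff₀ (by positivity), mul_pow]
        calc _ ≤ ε ^ (n + 1) * (2 ^ (n + 1) * (Nat.factorial (n + 1) : ℝ)) := by gcongr
          _ = _ := by ring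
      · rw [hpo, abs_zero, zero_mul, Real.zero_rpow (by positivity)]
        exact hs.le
    · rw [hcoeff, hpow n, ← Real.div_rpow (by positivity) (by positivity)]
      refine Real.rpow_le_rpow (by positivity) ?_ (by positivity)
      have h : 2 ^ n * (Nat.factorial n : ℝ) ≤ (Nat.doubleFactorial (2 * n + 1) : ℝ) := by
        exact_mod_cast (doubleFactorial_odd_bounds n).1
      calc (2 * ε) ^ (n + 1) / ((2 * (n + 1) : ℕ) : ℝ)
          = ε ^ (n + 1) / (Nat.factorial (n + 1) : ℝ) * (2 ^ n * (Nat.factorial n : ℝ)) := by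
            rw [Nat.factorial_succ, mul_pow]
            push_cast
            field_simp
            ring
        _ ≤ _ := by gcongr
  exact ⟨hlim, fun h => hs.ne' (hlim.symm.trans h)⟩
end

section
/- Let F : ℂ → ℂ be an entire function whose restriction f to ℝ does not vanish (F(x) ≠ 0 for all x ∈ ℝ), and let g : ℝ → ℂ be a continuous function such that exp(g(x)) = F(x) for all x ∈ ℝ. Then g is real-entire (i.e. g equals on all of ℝ a power series with infinite radius of convergence, equivalently g extends to an entire function ℂ → ℂ) if and only if F does not vanish on ℂ, i.e. F(z) ≠ 0 for every z ∈ ℂ. -/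
open Complex in
/-- A nowhere vanishing entire function has an entire logarithm with a prescribed value at `0`. -/
theorem exists_differentiable_exp_eq {F : ℂ → ℂ} (hF : Differentiable ℂ F) (hF0 : ∀ z, F z ≠ 0)
    {w : ℂ} (hw : exp w = F 0) :
    ∃ G : ℂ → ℂ, Differentiable ℂ G ∧ G 0 = w ∧ ∀ z, exp (G z) = F z := by
  have hlog : Differentiable ℂ fun z => deriv F z / F z :=
    hF.deriv.div hF hF0
  obtain ⟨G, hG0, hG⟩ := hlog.isExactOn_univ.with_val_at 0 w
  have hG (z : ℂ) : HasDerivAt G (deriv F z / F z) z := hG z trivial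
  refine ⟨G, fun z => (hG z).differentiableAt, hG0, fun z => ?_⟩
  have hd (z : ℂ) : HasDerivAt (fun z => F z * exp (-G z)) 0 z := by
    refine ((hF z).hasDerivAt.mul (hG z).neg.cexp).congr_deriv ?_
    have := hF0 z
    simp only [Pi.neg_apply]
    field_simp
    ring
  have hconst : F z * exp (-G z) = F 0 * exp (-G 0) :=
    is_const_of_deriv_eq_zero (fun z => (hd z).differentiableAt) (fun z => (hd z).deriv) z 0
  rw [hG0, ← hw, ← exp_add, add_neg_cancel, exp_zero, exp_neg] at hconst
  exact (eq_of_mul_inv_eq_one hconst).symm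

/-- Two continuous logarithms of the same function on a connected space which agree at one point
are equal. -/
theorem Continuous.eq_of_cexp_comp_eq {X : Type*} [TopologicalSpace X] [PreconnectedSpace X]
    {g₁ g₂ : X → ℂ} (h₁ : Continuous g₁) (h₂ : Continuous g₂)
    (he : ∀ x, Complex.exp (g₁ x) = Complex.exp (g₂ x)) (x₀ : X) (hx₀ : g₁ x₀ = g₂ x₀) :
    g₁ = g₂ :=
  Complex.isCoveringMap_exp.eq_of_comp_eq h₁ h₂ (funext fun x => Subtype.ext (he x)) x₀ hx₀

/-- A power series which converges absolutely on all of `ℝ` defines an entire function. -/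
theorem differentiable_tsum_mul_pow {a : ℕ → ℂ}
    (ha : ∀ x : ℝ, Summable fun k => ‖a k‖ * |x| ^ k) :
    Differentiable ℂ fun z : ℂ => ∑' k, a k * z ^ k := by
  intro z
  refine (Complex.differentiableOn_tsum_of_summable_norm (ha (‖z‖ + 1))
    (fun k => by fun_prop) (Metric.isOpen_ball (x := (0 : ℂ)) (ε := ‖z‖ + 1))
    fun k w hw => ?_).differentiableAt (Metric.isOpen_ball.mem_nhds (by simp))
  rw [norm_mul, norm_pow, abs_of_nonneg (by positivity)]
  gcongr
  exact (mem_ball_zero_iff.mp hw).le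

/-- Two entire functions which agree on the real line are equal. -/
theorem Differentiable.eq_of_forall_ofReal_eq {f g : ℂ → ℂ} (hf : Differentiable ℂ f)
    (hg : Differentiable ℂ g) (h : ∀ x : ℝ, f x = g x) : f = g := by
  have htend : Filter.Tendsto ((↑) : ℝ → ℂ) (nhdsWithin 0 {0}ᶜ) (nhdsWithin 0 {0}ᶜ) :=
    tendsto_nhdsWithin_iff.mpr ⟨(Complex.continuous_ofReal.tendsto' 0 0 (by simp)).mono_left
      nhdsWithin_le_nhds, by filter_upwards [self_mem_nhdsWithin] with x hx; simpa using hx⟩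
  exact AnalyticOnNhd.eq_of_frequently_eq (fun z _ => hf.analyticAt z) (fun z _ => hg.analyticAt z)
    (htend.frequently (Filter.Frequently.of_forall h))


/-- entire logarithms and non-vanishing extensions. Let `F : ℂ → ℂ` be
entire, non-vanishing on `ℝ`, and let `g : ℝ → ℂ` be a continuous logarithm of the
restriction of `F` to `ℝ`, i.e. `exp(g(x)) = F(x)` for all real `x`. Then `g` is
real-entire (equal on all of `ℝ` to a power series with infinite radius of convergence)
if and only if `F` does not vanish anywhere on `ℂ`. -/
theorem stmt18 (F : ℂ → ℂ) (hF : Differentiable ℂ F)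
    (hFreal : ∀ x : ℝ, F x ≠ 0)
    (g : ℝ → ℂ) (hg : Continuous g)
    (hgf : ∀ x : ℝ, Complex.exp (g x) = F x) :
    (∃ a : ℕ → ℂ,
      (∀ x : ℝ, Summable fun k => ‖a k‖ * |x| ^ k) ∧
      ∀ x : ℝ, g x = ∑' k : ℕ, a k * (x : ℂ) ^ k) ↔
    ∀ z : ℂ, F z ≠ 0 := by
  refine ⟨fun ⟨a, ha, hga⟩ => ?_, fun hF0 => ?_⟩
  · have hG := differentiable_tsum_mul_pow ha
    rw [hF.eq_of_forall_ofReal_eq hG.cexp fun x => by rw [← hgf x, hga x]]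
    exact fun z => Complex.exp_ne_zero _
  · obtain ⟨G, hG, hG0, hexp⟩ :=
      exists_differentiable_exp_eq hF hF0 (w := g 0) (by simpa using hgf 0)
    have hgG : g = fun x : ℝ => G x :=
      hg.eq_of_cexp_comp_eq (hG.continuous.comp Complex.continuous_ofReal)
        (fun x => by rw [hgf, hexp]) 0 (by simp [hG0])
    have hsum (x : ℝ) :
        HasSum (fun k : ℕ => (k.factorial : ℂ)⁻¹ * iteratedDeriv k G 0 * (x : ℂ) ^ k) (g x) := by
      rw [hgG]
      convert! Complex.hasSum_taylorSeries_of_entire hG 0 x using 2 with k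
      simp only [sub_zero, smul_eq_mul]
      ring
    refine ⟨_, fun x => ?_, fun x => (hsum x).tsum_eq.symm⟩
    simpa only [norm_mul, norm_pow, Complex.norm_real, Real.norm_eq_abs] using (hsum x).summable.norm
end
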